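/- Let σ > 0. The function t ↦ log(1 − Φ_σ(t)) is concave on ℝ, where Φ_σ is the CDF of a real Gaussian random variable with mean 0 and variance σ². -/

import Mathlib

/-- PDF of a real Gaussian with mean 0 and variance σ². -/
noncomputable def gaussPhi (σ t : ℝ) : ℝ :=
  (Real.sqrt (2 * Real.pi * σ ^ 2))⁻¹ * Real.exp (-(t ^ 2) / (2 * σ ^ 2))

/-- CDF of a real Gaussian with mean 0 and variance σ². -/
noncomputable def gaussPhiCDF (σ t : ℝ) : ℝ := ∫ u in Set.Iic t, gaussPhi σ u

open MeasureTheory Set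

theorem gaussPhi_eq_gaussianPDFReal (σ : ℝ) :
    gaussPhi σ = ProbabilityTheory.gaussianPDFReal 0 (σ ^ 2).toNNReal := by
  ext t
  simp [gaussPhi, ProbabilityTheory.gaussianPDFReal, Real.coe_toNNReal _ (sq_nonneg σ)]

theorem continuous_gaussPhi (σ : ℝ) : Continuous (gaussPhi σ) := by
  unfold gaussPhi
  fun_prop

theorem integrable_gaussPhi (σ : ℝ) : Integrable (gaussPhi σ) := by
  rw [gaussPhi_eq_gaussianPDFReal]
  exact ProbabilityTheory.integrable_gaussianPDFReal _ _

theorem gaussPhi_pos {σ : ℝ} (hσ : 0 < σ) (t : ℝ) : 0 < gaussPhi σ t := by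
  have := Real.pi_pos
  unfold gaussPhi
  positivity

theorem integral_gaussPhi {σ : ℝ} (hσ : 0 < σ) : ∫ t, gaussPhi σ t = 1 := by
  rw [gaussPhi_eq_gaussianPDFReal]
  exact ProbabilityTheory.integral_gaussianPDFReal_eq_one _
    (Real.toNNReal_pos.2 (pow_pos hσ 2)).ne'

theorem one_sub_gaussPhiCDF {σ : ℝ} (hσ : 0 < σ) (t : ℝ) :
    1 - gaussPhiCDF σ t = ∫ u in Ioi t, gaussPhi σ u := by
  have hi := integrable_gaussPhi σ
  rw [← integral_gaussPhi hσ, gaussPhiCDF,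
    ← intervalIntegral.integral_Iic_add_Ioi (b := t) hi.integrableOn hi.integrableOn]
  ring

theorem one_sub_gaussPhiCDF_pos {σ : ℝ} (hσ : 0 < σ) (t : ℝ) : 0 < 1 - gaussPhiCDF σ t := by
  rw [one_sub_gaussPhiCDF hσ, setIntegral_pos_iff_support_of_nonneg_ae
    (ae_of_all _ fun u => (gaussPhi_pos hσ u).le) (integrable_gaussPhi σ).integrableOn]
  have : Function.support (gaussPhi σ) = univ :=
    eq_univ_of_forall fun u => (gaussPhi_pos hσ u).ne'
  simp [this]

theorem one_sub_gaussPhiCDF_eq_integral_Ioi_zero {σ : ℝ} (hσ : 0 < σ) (t : ℝ) :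
    1 - gaussPhiCDF σ t = ∫ s in Ioi 0, gaussPhi σ (s + t) := by
  have h := (measurePreserving_add_right volume t).setIntegral_preimage_emb
    (MeasurableEquiv.addRight t).measurableEmbedding (gaussPhi σ) (Ioi t)
  rw [one_sub_gaussPhiCDF hσ, ← h, preimage_add_const_Ioi, sub_self]

theorem hasDerivAt_gaussPhiCDF (σ t : ℝ) : HasDerivAt (gaussPhiCDF σ) (gaussPhi σ t) t := by
  have hi := integrable_gaussPhi σ
  have h : gaussPhiCDF σ = fun x => gaussPhiCDF σ 0 + ∫ u in (0 : ℝ)..x, gaussPhi σ u := by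
    ext x
    rw [← intervalIntegral.integral_Iic_sub_Iic hi.integrableOn hi.integrableOn]
    simp [gaussPhiCDF]
  rw [h]
  exact ((continuous_gaussPhi σ).integral_hasStrictDerivAt 0 t).hasDerivAt.const_add _

theorem gaussPhi_mul_gaussPhi_add_le (σ : ℝ) {a b s : ℝ} (hab : a ≤ b) (hs : 0 ≤ s) :
    gaussPhi σ a * gaussPhi σ (s + b) ≤ gaussPhi σ b * gaussPhi σ (s + a) := by
  unfold gaussPhi
  rw [mul_mul_mul_comm, mul_mul_mul_comm _ _ _ (Real.exp (-((s + a) ^ 2) / _)),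
    ← Real.exp_add, ← Real.exp_add, ← add_div, ← add_div]
  gcongr _ * Real.exp (?_ / _)
  nlinarith [mul_nonneg hs (sub_nonneg.2 hab)]

/-- The hazard rate of a centered Gaussian is nondecreasing. -/
theorem monotone_gaussPhi_div_one_sub_gaussPhiCDF {σ : ℝ} (hσ : 0 < σ) :
    Monotone fun t => gaussPhi σ t / (1 - gaussPhiCDF σ t) := by
  intro a b hab
  have hi := integrable_gaussPhi σ
  dsimp only
  rw [div_le_div_iff₀ (one_sub_gaussPhiCDF_pos hσ a) (one_sub_gaussPhiCDF_pos hσ b),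
    one_sub_gaussPhiCDF_eq_integral_Ioi_zero hσ a, one_sub_gaussPhiCDF_eq_integral_Ioi_zero hσ b,
    ← integral_const_mul, ← integral_const_mul]
  exact setIntegral_mono_on ((hi.comp_add_right b).const_mul _).integrableOn
    ((hi.comp_add_right a).const_mul _).integrableOn measurableSet_Ioi
    fun s hs => gaussPhi_mul_gaussPhi_add_le σ hab (le_of_lt hs)

/-- t ↦ log(1 − Φ_σ(t)) is concave on ℝ. -/
theorem log_gaussCCDF_concave (σ : ℝ) (hσ : 0 < σ) :
    ConcaveOn ℝ Set.univ (fun t => Real.log (1 - gaussPhiCDF σ t)) := by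
  have hd : ∀ t, HasDerivAt (fun t => Real.log (1 - gaussPhiCDF σ t))
      (-gaussPhi σ t / (1 - gaussPhiCDF σ t)) t := fun t =>
    ((hasDerivAt_gaussPhiCDF σ t).const_sub 1).log (one_sub_gaussPhiCDF_pos hσ t).ne'
  refine Antitone.concaveOn_univ_of_deriv (fun t => (hd t).differentiableAt) fun a b hab => ?_
  rw [(hd a).deriv, (hd b).deriv, neg_div, neg_div]
  exact neg_le_neg (monotone_gaussPhi_div_one_sub_gaussPhiCDF hσ hab)
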